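/- Let d ∈ [0,1] and let (k_n)_{n≥1} be a sequence of integers with 0 ≤ k_n ≤ n such that k_n/n → 1 − d as n → ∞. Then lim_{n→∞} C_{n,k_n} = C(d). -/

import Mathlib

open scoped BigOperators

noncomputable section

/-- Output alphabet of the binary deletion channel with `n` input bits:
a length `k ≤ n` together with a binary string of that length. -/
abbrev DelOut (n : ℕ) := Σ k : Fin (n + 1), (Fin (k : ℕ) → Bool)

/-- The subsequence of `x` indexed by `S` (taken in increasing order),
as an element of `DelOut n`. -/
def restrictSub {n : ℕ} (x : Fin n → Bool) (S : Finset (Fin n)) : DelOut n :=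
  ⟨⟨S.card, Nat.lt_succ_of_le (by simpa using Finset.card_le_univ S)⟩,
   fun i => x (S.orderEmbOfFin rfl i)⟩

/-- Transition probability of the binary deletion channel `W_n^d`: each input bit is
deleted independently with probability `d`. -/
def delW {n : ℕ} (d : ℝ) (x : Fin n → Bool) (y : DelOut n) : ℝ :=
  ∑ S : Finset (Fin n),
    if restrictSub x S = y then (1 - d) ^ S.card * d ^ (n - S.card) else 0

/-- Transition probability of the exact deletion channel `W_{n,k}`, which keeps exactly `k`
of the `n` input bits, the kept positions being a uniformly random `k`-subset; `k`-subsets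
are identified with strictly monotone maps `Fin k → Fin n`. -/
def exactW {n k : ℕ} (x : Fin n → Bool) (y : Fin k → Bool) : ℝ :=
  ((Finset.univ.filter fun f : Fin k → Fin n => StrictMono f ∧ x ∘ f = y).card : ℝ) /
    (n.choose k : ℝ)

/-- `p` is a probability distribution on the finite alphabet `α`. -/
def IsDist {α : Type*} [Fintype α] (p : α → ℝ) : Prop :=
  (∀ a, 0 ≤ p a) ∧ ∑ a, p a = 1

/-- Base-2 mutual information `I(X;Y)` between the input `X ~ p` and the output `Y`
of the channel with transition matrix `W`. -/
def mutualInfo {α β : Type*} [Fintype α] [Fintype β] (p : α → ℝ) (W : α → β → ℝ) : ℝ :=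
  ∑ x, ∑ y, p x * W x y * Real.logb 2 (W x y / ∑ x', p x' * W x' y)

/-- `C_n(d) = (1/n) · sup_p I(X ; W_n^d(X))`. -/
def Cn (n : ℕ) (d : ℝ) : ℝ :=
  (1 / (n : ℝ)) * ⨆ p : {p : (Fin n → Bool) → ℝ // IsDist p}, mutualInfo p.1 (delW d)

/-- `C_{n,k} = (1/n) · sup_p I(X ; W_{n,k}(X))`. -/
def Cnk (n k : ℕ) : ℝ :=
  (1 / (n : ℝ)) * ⨆ p : {p : (Fin n → Bool) → ℝ // IsDist p},
    mutualInfo p.1 (exactW (n := n) (k := k))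

/-- Capacity of the binary deletion channel: `C(d) = inf_{n ≥ 1} C_n(d)`. -/
def C (d : ℝ) : ℝ := ⨅ n : {m : ℕ // 1 ≤ m}, Cn n d

/-! ### Mutual information of finite channels -/

section Channels

set_option linter.unusedSectionVars false

variable {α β γ : Type*} [Fintype α] [Fintype β] [Fintype γ]

/-- `W` is a stochastic matrix, i.e. the transition matrix of a channel. -/
structure IsChannel (W : α → β → ℝ) : Prop where
  nonneg : ∀ x y, 0 ≤ W x y
  sum_eq_one : ∀ x, ∑ y, W x y = 1

/-- The output distribution of the channel `W` on input distribution `p`. -/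
def outDist (p : α → ℝ) (W : α → β → ℝ) (y : β) : ℝ := ∑ x, p x * W x y

/-- The cascade of the channel `W` followed by the channel `V`. -/
def cascade (W : α → β → ℝ) (V : β → γ → ℝ) (x : α) (z : γ) : ℝ := ∑ y, W x y * V y z

lemma mutualInfo_eq_outDist (p : α → ℝ) (W : α → β → ℝ) :
    mutualInfo p W = ∑ x, ∑ y, p x * W x y * Real.logb 2 (W x y / outDist p W y) := rfl

/-- Gibbs' inequality, in the form of Jensen's inequality for the logarithm. -/
lemma sum_mul_logb_le {ι : Type*} [Fintype ι] {P t : ι → ℝ} {M : ℝ} (hM : 0 < M)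
    (hP : ∀ i, 0 ≤ P i) (hsum : ∑ i, P i = 1) (ht : ∀ i, 0 < P i → 0 < t i)
    (h : ∑ i, P i * t i ≤ M) : ∑ i, P i * Real.logb 2 (t i) ≤ Real.logb 2 M := by
  have h2 : 0 < Real.log 2 := Real.log_pos one_lt_two
  have key : ∑ i, P i * Real.log (t i) ≤ Real.log M := by
    calc ∑ i, P i * Real.log (t i)
        ≤ ∑ i, (P i * Real.log M + P i * t i / M - P i) := by
          refine Finset.sum_le_sum fun i _ => ?_
          rcases (hP i).eq_or_lt with h0 | h0
          · simp [← h0]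
          · have h3 := Real.log_le_sub_one_of_pos (div_pos (ht i h0) hM)
            rw [Real.log_div (ht i h0).ne' hM.ne'] at h3
            have h4 := mul_le_mul_of_nonneg_left h3 h0.le
            have h5 : P i * (t i / M - 1) = P i * t i / M - P i := by ring
            linarith [mul_sub (P i) (Real.log (t i)) (Real.log M)]
      _ = Real.log M + (∑ i, P i * t i) / M - 1 := by
          rw [Finset.sum_sub_distrib, Finset.sum_add_distrib, ← Finset.sum_mul, hsum,
            ← Finset.sum_div, one_mul]
      _ ≤ Real.log M := by
          have : (∑ i, P i * t i) / M ≤ 1 := (div_le_one hM).2 h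
          linarith
  simp only [Real.logb, ← mul_div_assoc, ← Finset.sum_div]
  gcongr

variable {p : α → ℝ} {W : α → β → ℝ} {V : β → γ → ℝ}

lemma outDist_nonneg (hp : IsDist p) (hW : IsChannel W) (y : β) : 0 ≤ outDist p W y :=
  Finset.sum_nonneg fun x _ => mul_nonneg (hp.1 x) (hW.nonneg x y)

lemma sum_outDist (hp : IsDist p) (hW : IsChannel W) : ∑ y, outDist p W y = 1 := by
  simp only [outDist]
  rw [Finset.sum_comm]
  simp [← Finset.mul_sum, hW.sum_eq_one, hp.2]

lemma mul_le_outDist (hp : IsDist p) (hW : IsChannel W) (x : α) (y : β) :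
    p x * W x y ≤ outDist p W y :=
  Finset.single_le_sum (f := fun x => p x * W x y)
    (fun x _ => mul_nonneg (hp.1 x) (hW.nonneg x y)) (Finset.mem_univ x)

lemma mul_le_cascade (hW : IsChannel W) (hV : IsChannel V) (x : α) (y : β) (z : γ) :
    W x y * V y z ≤ cascade W V x z :=
  Finset.single_le_sum (f := fun y => W x y * V y z)
    (fun y _ => mul_nonneg (hW.nonneg x y) (hV.nonneg y z)) (Finset.mem_univ y)

lemma IsChannel.cascade (hW : IsChannel W) (hV : IsChannel V) : IsChannel (cascade W V) where
  nonneg x z := Finset.sum_nonneg fun y _ => mul_nonneg (hW.nonneg x y) (hV.nonneg y z)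
  sum_eq_one x := by
    simp only [_root_.cascade]
    rw [Finset.sum_comm]
    simp [← Finset.mul_sum, hV.sum_eq_one, hW.sum_eq_one]

lemma outDist_cascade (p : α → ℝ) (W : α → β → ℝ) (V : β → γ → ℝ) (z : γ) :
    outDist p (cascade W V) z = ∑ y, outDist p W y * V y z := by
  simp only [outDist, cascade, Finset.mul_sum, Finset.sum_mul]
  rw [Finset.sum_comm]
  simp only [mul_assoc]

lemma mutualInfo_eq_sum_triple (hV : IsChannel V) :
    mutualInfo p W = ∑ i : α × β × γ, p i.1 * W i.1 i.2.1 * V i.2.1 i.2.2 *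
      Real.logb 2 (W i.1 i.2.1 / outDist p W i.2.1) := by
  simp only [Fintype.sum_prod_type, mutualInfo_eq_outDist]
  refine Finset.sum_congr rfl fun x _ => Finset.sum_congr rfl fun y _ => ?_
  rw [← Finset.sum_mul, ← Finset.mul_sum, hV.sum_eq_one, mul_one]

lemma mutualInfo_cascade_eq_sum_triple :
    mutualInfo p (cascade W V) = ∑ i : α × β × γ, p i.1 * W i.1 i.2.1 * V i.2.1 i.2.2 *
      Real.logb 2 (cascade W V i.1 i.2.2 / outDist p (cascade W V) i.2.2) := by
  simp only [Fintype.sum_prod_type, mutualInfo_eq_outDist]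
  refine Finset.sum_congr rfl fun x _ => ?_
  rw [Finset.sum_comm]
  refine Finset.sum_congr rfl fun z _ => ?_
  rw [← Finset.sum_mul]
  simp only [mul_assoc, ← Finset.mul_sum]
  rfl

lemma sum_triple_eq_one (hp : IsDist p) (hW : IsChannel W) (hV : IsChannel V) :
    ∑ i : α × β × γ, p i.1 * W i.1 i.2.1 * V i.2.1 i.2.2 = 1 := by
  simp [Fintype.sum_prod_type, ← Finset.mul_sum, hV.sum_eq_one, hW.sum_eq_one, hp.2]

lemma pos_of_triple_pos (hp : IsDist p) (hW : IsChannel W) (hV : IsChannel V) {x : α} {y : β}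
    {z : γ} (h : 0 < p x * W x y * V y z) :
    0 < p x ∧ 0 < W x y ∧ 0 < V y z ∧ 0 < outDist p W y ∧ 0 < cascade W V x z ∧
      0 < outDist p (cascade W V) z := by
  have hx : 0 < p x := (hp.1 x).lt_of_ne fun h0 => by simp [← h0] at h
  have hy : 0 < W x y := (hW.nonneg x y).lt_of_ne fun h0 => by simp [← h0] at h
  have hz : 0 < V y z := (hV.nonneg y z).lt_of_ne fun h0 => by simp [← h0] at h
  have hc := (mul_pos hy hz).trans_le (mul_le_cascade hW hV x y z)
  exact ⟨hx, hy, hz, (mul_pos hx hy).trans_le (mul_le_outDist hp hW x y), hc,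
    (mul_pos hx hc).trans_le (mul_le_outDist hp (hW.cascade hV) x z)⟩

/-- Data processing inequality. -/
lemma mutualInfo_cascade_le (hp : IsDist p) (hW : IsChannel W) (hV : IsChannel V) :
    mutualInfo p (cascade W V) ≤ mutualInfo p W := by
  rw [mutualInfo_eq_sum_triple (W := W) hV, mutualInfo_cascade_eq_sum_triple, ← sub_nonpos,
    ← Finset.sum_sub_distrib]
  refine le_of_eq_of_le ?_ ((sum_mul_logb_le (M := 1)
    (P := fun i : α × β × γ => p i.1 * W i.1 i.2.1 * V i.2.1 i.2.2)
    (t := fun i => (cascade W V i.1 i.2.2 / outDist p (cascade W V) i.2.2) /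
      (W i.1 i.2.1 / outDist p W i.2.1)) one_pos
    (fun i => mul_nonneg (mul_nonneg (hp.1 _) (hW.nonneg _ _)) (hV.nonneg _ _))
    (sum_triple_eq_one hp hW hV) ?_ ?_).trans_eq Real.logb_one)
  · refine Finset.sum_congr rfl fun ⟨x, y, z⟩ _ => ?_
    rcases (mul_nonneg (mul_nonneg (hp.1 x) (hW.nonneg x y)) (hV.nonneg y z)).eq_or_lt with h | h
    · simp [← h]
    · obtain ⟨_, hy, _, hq, hc, hr⟩ := pos_of_triple_pos hp hW hV h
      rw [← mul_sub, Real.logb_div (div_pos hc hr).ne' (div_pos hy hq).ne']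
  · rintro ⟨x, y, z⟩ h
    obtain ⟨_, hy, _, hq, hc, hr⟩ := pos_of_triple_pos hp hW hV h
    exact div_pos (div_pos hc hr) (div_pos hy hq)
  · have hc := hW.cascade hV
    calc _ ≤ ∑ i : α × β × γ, p i.1 * (cascade W V i.1 i.2.2 / outDist p (cascade W V) i.2.2 *
            (outDist p W i.2.1 * V i.2.1 i.2.2)) := by
          refine Finset.sum_le_sum fun ⟨x, y, z⟩ _ => ?_
          dsimp only
          have h1 := outDist_nonneg hp hW y
          have h2 := outDist_nonneg hp hc z
          rcases (hW.nonneg x y).eq_or_lt with h | h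
          · simp only [← h, mul_zero, zero_mul]
            exact mul_nonneg (hp.1 x) (mul_nonneg (div_nonneg (hc.nonneg x z) h2)
              (mul_nonneg h1 (hV.nonneg y z)))
          · apply le_of_eq
            field_simp
      _ = ∑ x, ∑ z, p x * (cascade W V x z / outDist p (cascade W V) z *
            outDist p (cascade W V) z) := by
          simp only [Fintype.sum_prod_type]
          refine Finset.sum_congr rfl fun x _ => ?_
          rw [Finset.sum_comm]
          refine Finset.sum_congr rfl fun z _ => ?_
          rw [← Finset.mul_sum, ← Finset.mul_sum, outDist_cascade p W V z]
      _ ≤ ∑ x, ∑ z, p x * cascade W V x z := by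
          refine Finset.sum_le_sum fun x _ => Finset.sum_le_sum fun z _ =>
            mul_le_mul_of_nonneg_left ?_ (hp.1 x)
          rcases (outDist_nonneg hp hc z).eq_or_lt with h | h
          · simpa [← h] using hc.nonneg x z
          · rw [div_mul_cancel₀ _ h.ne']
      _ = 1 := by simp [← Finset.mul_sum, hc.sum_eq_one, hp.2]

/-- Passing through a channel `V` each of whose outputs has at most `M` possible inputs loses at
most `log₂ M` bits of information. -/
lemma mutualInfo_le_cascade_add (hp : IsDist p) (hW : IsChannel W)
    (hV : IsChannel V) {M : ℝ} (hM : 0 < M)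
    (hcard : ∀ z, ((Finset.univ.filter fun y => V y z ≠ 0).card : ℝ) ≤ M) :
    mutualInfo p W ≤ mutualInfo p (cascade W V) + Real.logb 2 M := by
  rw [mutualInfo_eq_sum_triple (W := W) hV, mutualInfo_cascade_eq_sum_triple, ← sub_le_iff_le_add',
    ← Finset.sum_sub_distrib]
  refine le_of_eq_of_le ?_ (sum_mul_logb_le (M := M)
    (P := fun i : α × β × γ => p i.1 * W i.1 i.2.1 * V i.2.1 i.2.2)
    (t := fun i => (W i.1 i.2.1 / outDist p W i.2.1) /
      (cascade W V i.1 i.2.2 / outDist p (cascade W V) i.2.2)) hM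
    (fun i => mul_nonneg (mul_nonneg (hp.1 _) (hW.nonneg _ _)) (hV.nonneg _ _))
    (sum_triple_eq_one hp hW hV) ?_ ?_)
  · refine Finset.sum_congr rfl fun ⟨x, y, z⟩ _ => ?_
    rcases (mul_nonneg (mul_nonneg (hp.1 x) (hW.nonneg x y)) (hV.nonneg y z)).eq_or_lt with h | h
    · simp [← h]
    · obtain ⟨_, hy, _, hq, hc, hr⟩ := pos_of_triple_pos hp hW hV h
      rw [← mul_sub, Real.logb_div (div_pos hy hq).ne' (div_pos hc hr).ne']
  · rintro ⟨x, y, z⟩ h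
    obtain ⟨_, hy, _, hq, hc, hr⟩ := pos_of_triple_pos hp hW hV h
    exact div_pos (div_pos hy hq) (div_pos hc hr)
  · have hc := hW.cascade hV
    calc _ ≤ ∑ i : α × β × γ, p i.1 * W i.1 i.2.1 / outDist p W i.2.1 *
            (if V i.2.1 i.2.2 ≠ 0 then outDist p (cascade W V) i.2.2 else 0) := by
          refine Finset.sum_le_sum fun ⟨x, y, z⟩ _ => ?_
          dsimp only
          have h1 := outDist_nonneg hp hW y
          have h2 := outDist_nonneg hp hc z
          have h3 := mul_nonneg (hp.1 x) (hW.nonneg x y)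
          rcases eq_or_ne (V y z) 0 with h | h
          · simp [h]
          · rw [if_pos h]
            have h4 : W x y * V y z / cascade W V x z ≤ 1 :=
              div_le_one_of_le₀ (mul_le_cascade hW hV x y z) (hc.nonneg x z)
            calc p x * W x y * V y z * (W x y / outDist p W y /
                    (cascade W V x z / outDist p (cascade W V) z))
                = p x * W x y / outDist p W y * outDist p (cascade W V) z *
                    (W x y * V y z / cascade W V x z) := by
                  rw [div_div_eq_mul_div]; ring
              _ ≤ p x * W x y / outDist p W y * outDist p (cascade W V) z :=
                  mul_le_of_le_one_right (mul_nonneg (div_nonneg h3 h1) h2) h4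
      _ = ∑ z, ∑ y, outDist p W y / outDist p W y *
            (if V y z ≠ 0 then outDist p (cascade W V) z else 0) := by
          simp only [Fintype.sum_prod_type]
          rw [Finset.sum_comm]
          simp only [fun y : β => Finset.sum_comm (s := (Finset.univ : Finset α))
            (t := (Finset.univ : Finset γ))
            (f := fun x z => p x * W x y / outDist p W y *
              (if V y z ≠ 0 then outDist p (cascade W V) z else 0))]
          rw [Finset.sum_comm]
          simp only [← Finset.sum_mul, ← Finset.sum_div, outDist]
      _ ≤ ∑ z, ∑ y, if V y z ≠ 0 then outDist p (cascade W V) z else 0 := by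
          refine Finset.sum_le_sum fun z _ => Finset.sum_le_sum fun y _ => ?_
          refine mul_le_of_le_one_left ?_ (div_self_le_one _)
          split_ifs
          exacts [outDist_nonneg hp hc z, le_rfl]
      _ = ∑ z, ((Finset.univ.filter fun y => V y z ≠ 0).card : ℝ) *
            outDist p (cascade W V) z := by
          simp [Finset.sum_ite]
      _ ≤ ∑ z, M * outDist p (cascade W V) z :=
          Finset.sum_le_sum fun z _ =>
            mul_le_mul_of_nonneg_right (hcard z) (outDist_nonneg hp hc z)
      _ = M := by rw [← Finset.mul_sum, sum_outDist hp hc, mul_one]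

lemma isChannel_unit : IsChannel fun (_ : α) (_ : Unit) => (1 : ℝ) where
  nonneg _ _ := zero_le_one
  sum_eq_one _ := by simp

lemma mutualInfo_cascade_unit (hp : IsDist p) (hW : IsChannel W) :
    mutualInfo p (cascade W fun _ (_ : Unit) => (1 : ℝ)) = 0 := by
  simp [mutualInfo, cascade, hW.sum_eq_one, hp.2]

lemma mutualInfo_nonneg (hp : IsDist p) (hW : IsChannel W) : 0 ≤ mutualInfo p W :=
  (mutualInfo_cascade_unit hp hW).symm.trans_le (mutualInfo_cascade_le hp hW isChannel_unit)

lemma mutualInfo_le_logb_card [Nonempty β] (hp : IsDist p) (hW : IsChannel W) :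
    mutualInfo p W ≤ Real.logb 2 (Fintype.card β) := by
  have h := mutualInfo_le_cascade_add (M := Fintype.card β) hp hW isChannel_unit
    (by exact_mod_cast Fintype.card_pos) (fun z => by exact_mod_cast Finset.card_le_univ _)
  rwa [mutualInfo_cascade_unit hp hW, zero_add] at h

lemma bddAbove_mutualInfo [Nonempty β] (hW : IsChannel W) :
    BddAbove (Set.range fun p : {p : α → ℝ // IsDist p} => mutualInfo p.1 W) :=
  ⟨Real.logb 2 (Fintype.card β), by
    rintro _ ⟨p, rfl⟩
    exact mutualInfo_le_logb_card p.2 hW⟩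

lemma nonempty_isDist [Nonempty α] : Nonempty {p : α → ℝ // IsDist p} := by
  classical
  obtain ⟨a⟩ := ‹Nonempty α›
  exact ⟨Pi.single a 1, fun b => by by_cases h : b = a <;> simp [h], by simp⟩

/-- The mutual information is invariant under relabelling of the inputs. -/
lemma mutualInfo_comp_equiv {δ : Type*} [Fintype δ] (e : δ ≃ α) (p : α → ℝ) (W : α → β → ℝ) :
    mutualInfo (p ∘ e) (W ∘ e) = mutualInfo p W := by
  simp only [mutualInfo, Function.comp_apply]
  simp only [fun y => e.sum_comp fun x => p x * W x y]
  exact e.sum_comp fun x => ∑ y, p x * W x y * Real.logb 2 (W x y / ∑ x', p x' * W x' y)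

lemma IsDist.comp_equiv {δ : Type*} [Fintype δ] (e : δ ≃ α) (hp : IsDist p) : IsDist (p ∘ e) :=
  ⟨fun a => hp.1 (e a), (e.sum_comp p).trans hp.2⟩

end Channels

section Product

set_option linter.unusedSectionVars false

variable {α₁ α₂ β₁ β₂ : Type*} [Fintype α₁] [Fintype α₂] [Fintype β₁] [Fintype β₂]
  {p : α₁ × α₂ → ℝ} {W₁ : α₁ → β₁ → ℝ} {W₂ : α₂ → β₂ → ℝ}

/-- The memoryless product of two channels. -/
def prodChannel (W₁ : α₁ → β₁ → ℝ) (W₂ : α₂ → β₂ → ℝ) (x : α₁ × α₂) (y : β₁ × β₂) : ℝ :=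
  W₁ x.1 y.1 * W₂ x.2 y.2

lemma IsChannel.prodChannel (h₁ : IsChannel W₁) (h₂ : IsChannel W₂) :
    IsChannel (prodChannel W₁ W₂) where
  nonneg x y := mul_nonneg (h₁.nonneg _ _) (h₂.nonneg _ _)
  sum_eq_one x := by
    simp [_root_.prodChannel, Fintype.sum_prod_type, ← Finset.mul_sum, h₁.sum_eq_one,
      h₂.sum_eq_one]

lemma IsDist.fst (hp : IsDist p) : IsDist fun x₁ => ∑ x₂, p (x₁, x₂) :=
  ⟨fun _ => Finset.sum_nonneg fun _ _ => hp.1 _, by rw [← Fintype.sum_prod_type, hp.2]⟩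

lemma IsDist.snd (hp : IsDist p) : IsDist fun x₂ => ∑ x₁, p (x₁, x₂) :=
  ⟨fun _ => Finset.sum_nonneg fun _ _ => hp.1 _, by rw [← Fintype.sum_prod_type_right, hp.2]⟩

lemma mutualInfo_fst_eq_sum (h₂ : IsChannel W₂) :
    mutualInfo (fun x₁ => ∑ x₂, p (x₁, x₂)) W₁ =
      ∑ i : (α₁ × α₂) × β₁ × β₂, p i.1 * prodChannel W₁ W₂ i.1 i.2 *
        Real.logb 2 (W₁ i.1.1 i.2.1 / outDist (fun x₁ => ∑ x₂, p (x₁, x₂)) W₁ i.2.1) := by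
  simp only [Fintype.sum_prod_type, mutualInfo_eq_outDist, prodChannel]
  refine Finset.sum_congr rfl fun x _ => ?_
  rw [Finset.sum_comm]
  refine Finset.sum_congr rfl fun y _ => ?_
  rw [Finset.sum_mul, Finset.sum_mul]
  refine Finset.sum_congr rfl fun x₂ _ => ?_
  rw [← Finset.sum_mul, ← Finset.mul_sum, ← Finset.mul_sum, h₂.sum_eq_one, mul_one]

lemma mutualInfo_snd_eq_sum (h₁ : IsChannel W₁) :
    mutualInfo (fun x₂ => ∑ x₁, p (x₁, x₂)) W₂ =
      ∑ i : (α₁ × α₂) × β₁ × β₂, p i.1 * prodChannel W₁ W₂ i.1 i.2 *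
        Real.logb 2 (W₂ i.1.2 i.2.2 / outDist (fun x₂ => ∑ x₁, p (x₁, x₂)) W₂ i.2.2) := by
  rw [Fintype.sum_prod_type, Fintype.sum_prod_type_right]
  simp only [Fintype.sum_prod_type_right, mutualInfo_eq_outDist, prodChannel]
  refine Finset.sum_congr rfl fun x _ => ?_
  rw [Finset.sum_comm]
  refine Finset.sum_congr rfl fun y _ => ?_
  rw [Finset.sum_mul, Finset.sum_mul]
  refine Finset.sum_congr rfl fun x₁ _ => ?_
  rw [← Finset.sum_mul, ← Finset.mul_sum, ← Finset.sum_mul, h₁.sum_eq_one, one_mul]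

/-- For a memoryless product channel, the mutual information is subadditive. -/
lemma mutualInfo_prodChannel_le (hp : IsDist p) (h₁ : IsChannel W₁) (h₂ : IsChannel W₂) :
    mutualInfo p (prodChannel W₁ W₂) ≤
      mutualInfo (fun x₁ => ∑ x₂, p (x₁, x₂)) W₁ + mutualInfo (fun x₂ => ∑ x₁, p (x₁, x₂)) W₂ := by
  have h := h₁.prodChannel h₂
  have e : mutualInfo p (prodChannel W₁ W₂) = ∑ i : (α₁ × α₂) × β₁ × β₂,
      p i.1 * prodChannel W₁ W₂ i.1 i.2 * Real.logb 2 (prodChannel W₁ W₂ i.1 i.2 /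
        outDist p (prodChannel W₁ W₂) i.2) := by
    rw [Fintype.sum_prod_type]
    rfl
  set p₁ : α₁ → ℝ := fun x₁ => ∑ x₂, p (x₁, x₂) with hp₁
  set p₂ : α₂ → ℝ := fun x₂ => ∑ x₁, p (x₁, x₂) with hp₂
  have q₁ := outDist_nonneg hp.fst h₁
  have q₂ := outDist_nonneg hp.snd h₂
  rw [e, mutualInfo_fst_eq_sum h₂, mutualInfo_snd_eq_sum h₁, ← sub_nonpos,
    ← Finset.sum_add_distrib, ← Finset.sum_sub_distrib]
  have pos : ∀ i : (α₁ × α₂) × β₁ × β₂, 0 < p i.1 * prodChannel W₁ W₂ i.1 i.2 →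
      0 < W₁ i.1.1 i.2.1 ∧ 0 < W₂ i.1.2 i.2.2 ∧ 0 < outDist p₁ W₁ i.2.1 ∧
        0 < outDist p₂ W₂ i.2.2 ∧ 0 < outDist p (prodChannel W₁ W₂) i.2 := by
    rintro ⟨⟨x₁, x₂⟩, y₁, y₂⟩ hi
    have hx : 0 < p (x₁, x₂) := (hp.1 _).lt_of_ne fun h0 => by simp [← h0] at hi
    have hy₁ : 0 < W₁ x₁ y₁ :=
      (h₁.nonneg _ _).lt_of_ne fun h0 => by simp [prodChannel, ← h0] at hi
    have hy₂ : 0 < W₂ x₂ y₂ :=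
      (h₂.nonneg _ _).lt_of_ne fun h0 => by simp [prodChannel, ← h0] at hi
    have hx₁ : 0 < p₁ x₁ := hx.trans_le (Finset.single_le_sum (f := fun x₂ => p (x₁, x₂))
      (fun _ _ => hp.1 _) (Finset.mem_univ x₂))
    have hx₂ : 0 < p₂ x₂ := hx.trans_le (Finset.single_le_sum (f := fun x₁ => p (x₁, x₂))
      (fun _ _ => hp.1 _) (Finset.mem_univ x₁))
    exact ⟨hy₁, hy₂, (mul_pos hx₁ hy₁).trans_le (mul_le_outDist hp.fst h₁ x₁ y₁),
      (mul_pos hx₂ hy₂).trans_le (mul_le_outDist hp.snd h₂ x₂ y₂),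
      hi.trans_le (mul_le_outDist hp h _ _)⟩
  have nonneg : ∀ i : (α₁ × α₂) × β₁ × β₂, 0 ≤ p i.1 * prodChannel W₁ W₂ i.1 i.2 :=
    fun i => mul_nonneg (hp.1 _) (h.nonneg _ _)
  refine le_of_eq_of_le ?_ ((sum_mul_logb_le (M := 1)
    (P := fun i : (α₁ × α₂) × β₁ × β₂ => p i.1 * prodChannel W₁ W₂ i.1 i.2)
    (t := fun i => outDist p₁ W₁ i.2.1 * outDist p₂ W₂ i.2.2 / outDist p (prodChannel W₁ W₂) i.2)
    one_pos nonneg ?_ ?_ ?_).trans_eq Real.logb_one)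
  · refine Finset.sum_congr rfl fun i _ => ?_
    rcases (nonneg i).eq_or_lt with h0 | h0
    · simp [← h0]
    · obtain ⟨a, b, c, d, e⟩ := pos i h0
      rw [← mul_add, ← mul_sub, prodChannel, Real.logb_div (mul_pos a b).ne' e.ne',
        Real.logb_div a.ne' c.ne', Real.logb_div b.ne' d.ne', Real.logb_div (mul_pos c d).ne' e.ne',
        Real.logb_mul a.ne' b.ne', Real.logb_mul c.ne' d.ne']
      ring
  · simp only [Fintype.sum_prod_type (f := fun i : (α₁ × α₂) × β₁ × β₂ =>
      p i.1 * prodChannel W₁ W₂ i.1 i.2), ← Finset.mul_sum, h.sum_eq_one, mul_one, hp.2]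
  · intro i h0
    obtain ⟨-, -, c, d, e⟩ := pos i h0
    exact div_pos (mul_pos c d) e
  · rw [Fintype.sum_prod_type_right]
    simp only [← Finset.sum_mul]
    calc ∑ y : β₁ × β₂, outDist p (prodChannel W₁ W₂) y * (outDist p₁ W₁ y.1 *
          outDist p₂ W₂ y.2 / outDist p (prodChannel W₁ W₂) y)
        ≤ ∑ y : β₁ × β₂, outDist p₁ W₁ y.1 * outDist p₂ W₂ y.2 := by
          refine Finset.sum_le_sum fun y _ => ?_
          rw [mul_div_left_comm]
          exact mul_le_of_le_one_right (mul_nonneg (q₁ _) (q₂ _)) (div_self_le_one _)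
      _ = 1 := by
          simp only [Fintype.sum_prod_type, ← Finset.mul_sum,
            sum_outDist hp.fst h₁, sum_outDist hp.snd h₂, hp₁, hp₂, mul_one]

end Product

/-! ### Exact deletion channels -/

section Exact

open Finset

/-- A strictly monotone map enumerates its image. -/
lemma StrictMono.eq_orderEmbOfFin_image {n k : ℕ} {f : Fin k → Fin n} (hf : StrictMono f)
    (h : (univ.image f).card = k) : f = (univ.image f).orderEmbOfFin h :=
  orderEmbOfFin_unique h (fun i => mem_image_of_mem f (mem_univ i)) hf

lemma StrictMono.card_image_univ {n k : ℕ} {f : Fin k → Fin n} (hf : StrictMono f) :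
    (univ.image f).card = k := by
  rw [card_image_of_injective _ hf.injective, card_univ, Fintype.card_fin]

lemma StrictMono.eq_of_image_eq {n k : ℕ} {f g : Fin k → Fin n} (hf : StrictMono f)
    (hg : StrictMono g) (h : univ.image f = univ.image g) : f = g := by
  rw [hf.eq_orderEmbOfFin_image hf.card_image_univ, hg.eq_orderEmbOfFin_image hg.card_image_univ]
  simp only [h]

lemma card_filter_strictMono (n k : ℕ) :
    (univ.filter fun f : Fin k → Fin n => StrictMono f).card = n.choose k := by
  have h : (powersetCard k (univ : Finset (Fin n))).card = n.choose k := by simp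
  rw [← h]
  refine card_bij (fun f _ => univ.image f) ?_ ?_ ?_
  · intro f hf
    exact mem_powersetCard.2 ⟨subset_univ _, (mem_filter.1 hf).2.card_image_univ⟩
  · intro f hf g hg hfg
    exact (mem_filter.1 hf).2.eq_of_image_eq (mem_filter.1 hg).2 hfg
  · intro S hS
    have hS := (mem_powersetCard.1 hS).2
    exact ⟨S.orderEmbOfFin hS, by simpa using (S.orderEmbOfFin hS).strictMono,
      image_orderEmbOfFin_univ S hS⟩

lemma isChannel_exactW {n k : ℕ} (hk : k ≤ n) : IsChannel (exactW (n := n) (k := k)) where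
  nonneg x y := by unfold exactW; positivity
  sum_eq_one x := by
    have h : (n.choose k : ℝ) ≠ 0 := by exact_mod_cast (Nat.choose_pos hk).ne'
    simp only [exactW, ← sum_div]
    rw [div_eq_one_iff_eq h, ← card_filter_strictMono n k,
      card_eq_sum_card_fiberwise (f := fun f => x ∘ f) (t := univ) (fun _ _ => mem_univ _)]
    simp only [filter_filter, Nat.cast_sum]

/-- The number of ways to factor a strictly monotone map through `Fin j`. -/
lemma card_strictMono_factorizations {n j k : ℕ} {h : Fin k → Fin n} (hh : StrictMono h)
    (hkj : k ≤ j) :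
    (univ.filter fun q : (Fin j → Fin n) × (Fin k → Fin j) =>
      (StrictMono q.1 ∧ StrictMono q.2) ∧ q.1 ∘ q.2 = h).card = (n - k).choose (j - k) := by
  have hc : (powersetCard (j - k) (univ.image h)ᶜ).card = (n - k).choose (j - k) := by
    simp [card_compl, hh.card_image_univ]
  have sub : ∀ {f : Fin j → Fin n} {g : Fin k → Fin j}, f ∘ g = h →
      univ.image h ⊆ univ.image f := by
    rintro f g rfl a ha
    obtain ⟨i, -, rfl⟩ := mem_image.1 ha
    exact mem_image_of_mem f (mem_univ (g i))
  rw [← hc]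
  refine card_bij (fun q _ => univ.image q.1 \ univ.image h) ?_ ?_ ?_
  · rintro ⟨f, g⟩ hq
    obtain ⟨⟨hf, hg⟩, hfg⟩ := (mem_filter.1 hq).2
    refine mem_powersetCard.2 ⟨fun a ha => mem_compl.2 (mem_sdiff.1 ha).2, ?_⟩
    rw [card_sdiff_of_subset (sub hfg), hf.card_image_univ, hh.card_image_univ]
  · rintro ⟨f, g⟩ hq ⟨f', g'⟩ hq' heq
    obtain ⟨⟨hf, hg⟩, hfg⟩ := (mem_filter.1 hq).2
    obtain ⟨⟨hf', hg'⟩, hfg'⟩ := (mem_filter.1 hq').2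
    dsimp only at hf hg hfg hf' hg' hfg' heq
    have : f = f' := hf.eq_of_image_eq hf' (by
      rw [← sdiff_union_of_subset (sub hfg), ← sdiff_union_of_subset (sub hfg'), heq])
    subst this
    have : g = g' := funext fun i => hf.injective (congrFun (hfg.trans hfg'.symm) i)
    rw [this]
  · intro S hS
    obtain ⟨hS, hcard⟩ := mem_powersetCard.1 hS
    have hdisj : Disjoint S (univ.image h) := by
      rw [← subset_compl_iff_disjoint_right]
      exact hS
    have hT : (S ∪ univ.image h).card = j := by
      rw [card_union_of_disjoint hdisj, hcard, hh.card_image_univ, Nat.sub_add_cancel hkj]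
    set f := (S ∪ univ.image h).orderEmbOfFin hT with hf
    have him : univ.image f = S ∪ univ.image h := image_orderEmbOfFin_univ _ hT
    have hex : ∀ i, ∃ l, f l = h i := fun i => by
      have : h i ∈ univ.image f := by
        rw [him]
        exact mem_union_right _ (mem_image_of_mem h (mem_univ i))
      simpa using this
    choose g hg using hex
    refine ⟨(f, g), mem_filter.2 ⟨mem_univ _, ⟨f.strictMono, fun a b hab => ?_⟩, funext hg⟩, ?_⟩
    · rw [← f.strictMono.lt_iff_lt, hg, hg]
      exact hh hab
    · dsimp only
      rw [him, union_sdiff_cancel_right hdisj]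

/-- Keeping `k` out of `n` symbols can be done in two stages, keeping first `j` symbols. -/
lemma cascade_exactW {n j k : ℕ} (hkj : k ≤ j) (hjn : j ≤ n) :
    cascade (exactW (n := n) (k := j)) (exactW (n := j) (k := k)) = exactW := by
  funext x y
  have hcount : ∑ z : Fin j → Bool,
      (univ.filter fun f : Fin j → Fin n => StrictMono f ∧ x ∘ f = z).card *
        (univ.filter fun g : Fin k → Fin j => StrictMono g ∧ z ∘ g = y).card =
      (univ.filter fun h : Fin k → Fin n => StrictMono h ∧ x ∘ h = y).card *
        (n - k).choose (j - k) := by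
    have e1 : ∑ z : Fin j → Bool,
        (univ.filter fun f : Fin j → Fin n => StrictMono f ∧ x ∘ f = z).card *
          (univ.filter fun g : Fin k → Fin j => StrictMono g ∧ z ∘ g = y).card =
        (univ.filter fun q : (Fin j → Fin n) × (Fin k → Fin j) =>
          (StrictMono q.1 ∧ StrictMono q.2) ∧ x ∘ q.1 ∘ q.2 = y).card := by
      rw [card_eq_sum_card_fiberwise (f := fun q => x ∘ q.1) (t := univ) (fun _ _ => mem_univ _)]
      refine sum_congr rfl fun z _ => ?_
      rw [← card_product]
      congr 1
      ext ⟨f, g⟩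
      simp only [mem_product, mem_filter, mem_univ, true_and]
      constructor
      · rintro ⟨⟨hf, rfl⟩, hg, hy⟩
        exact ⟨⟨⟨hf, hg⟩, hy⟩, rfl⟩
      · rintro ⟨⟨⟨hf, hg⟩, hy⟩, rfl⟩
        exact ⟨⟨hf, rfl⟩, hg, hy⟩
    rw [e1, card_eq_sum_card_fiberwise (f := fun q => q.1 ∘ q.2)
      (t := univ.filter fun h : Fin k → Fin n => StrictMono h ∧ x ∘ h = y)]
    · rw [← smul_eq_mul]
      refine sum_eq_card_nsmul fun h hmem => ?_
      obtain ⟨hh, hy⟩ := (mem_filter.1 hmem).2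
      rw [← card_strictMono_factorizations hh hkj, filter_filter]
      congr 1
      ext ⟨f, g⟩
      simp only [mem_filter, mem_univ, true_and]
      constructor
      · rintro ⟨⟨hs, -⟩, hfg⟩
        exact ⟨hs, hfg⟩
      · rintro ⟨hs, rfl⟩
        exact ⟨⟨hs, hy⟩, rfl⟩
    · rintro ⟨f, g⟩ hq
      obtain ⟨⟨hf, hg⟩, hy⟩ := (mem_filter.1 hq).2
      exact mem_filter.2 ⟨mem_univ _, hf.comp hg, hy⟩
  have h1 : (n.choose j : ℝ) * j.choose k = n.choose k * (n - k).choose (j - k) := by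
    exact_mod_cast Nat.choose_mul hkj
  have h2 : (n.choose j : ℝ) ≠ 0 := by exact_mod_cast (Nat.choose_pos hjn).ne'
  have h3 : (j.choose k : ℝ) ≠ 0 := by exact_mod_cast (Nat.choose_pos hkj).ne'
  have h4 : (n.choose k : ℝ) ≠ 0 := by exact_mod_cast (Nat.choose_pos (hkj.trans hjn)).ne'
  simp only [cascade, exactW, div_mul_div_comm, ← sum_div]
  rw [div_eq_div_iff (mul_ne_zero h2 h3) h4, h1]
  have := congrArg (Nat.cast (R := ℝ)) hcount
  push_cast at this
  rw [this]
  ring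

/-- A binary string of length `k` has at most `C(j, k) 2 ^ (j - k)` supersequences of
length `j`. -/
lemma card_filter_exactW_ne_zero_le {j k : ℕ} (y : Fin k → Bool) :
    (univ.filter fun z : Fin j → Bool => exactW z y ≠ 0).card ≤ j.choose k * 2 ^ (j - k) := by
  have hsub : (univ.filter fun z : Fin j → Bool => exactW z y ≠ 0) ⊆
      (univ.filter fun g : Fin k → Fin j => StrictMono g).biUnion
        fun g => univ.filter fun z : Fin j → Bool => z ∘ g = y := by
    intro z hz
    have hz := (mem_filter.1 hz).2
    have hne : (univ.filter fun g : Fin k → Fin j => StrictMono g ∧ z ∘ g = y).Nonempty := by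
      rw [nonempty_iff_ne_empty]
      intro h0
      simp [exactW, h0] at hz
    obtain ⟨g, hg⟩ := hne
    obtain ⟨hg, hy⟩ := (mem_filter.1 hg).2
    exact mem_biUnion.2 ⟨g, by simpa using hg, by simpa using hy⟩
  refine (card_le_card hsub).trans ?_
  rw [← card_filter_strictMono]
  refine card_biUnion_le_card_mul _ _ _ fun g hg => ?_
  have hg : StrictMono g := (mem_filter.1 hg).2
  have hc : Fintype.card ({i // i ∉ univ.image g} → Bool) = 2 ^ (j - k) := by
    simp only [Fintype.card_fun, Fintype.card_bool, Fintype.card_subtype_compl, Fintype.card_fin,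
      Fintype.card_coe, hg.card_image_univ]
  rw [← hc, ← card_univ]
  refine card_le_card_of_injOn (fun z i => z i.1) (fun _ _ => mem_univ _) ?_
  intro z hz z' hz' heq
  have hz : z ∘ g = y := by simpa using hz
  have hz' : z' ∘ g = y := by simpa using hz'
  funext i
  by_cases hi : i ∈ univ.image g
  · obtain ⟨l, -, rfl⟩ := mem_image.1 hi
    exact (congrFun hz l).trans (congrFun hz' l).symm
  · exact congrFun heq ⟨i, hi⟩

/-- A Chernoff-type bound on binomial coefficients. -/
lemma logb_choose_le {n j k : ℕ} (hkj : k ≤ j) (hjn : j ≤ n) (s : ℕ) :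
    Real.logb 2 (j.choose k) ≤ s * (j - k : ℝ) + 2 * (1 / 2) ^ s * n := by
  have h2 : 0 < Real.log 2 := Real.log_pos one_lt_two
  have ht : (0 : ℝ) < (1 / 2) ^ s := by positivity
  have hpos : (0 : ℝ) < j.choose k := by exact_mod_cast Nat.choose_pos hkj
  have h1 : (j.choose k : ℝ) * ((1 / 2) ^ s) ^ (j - k) ≤ (1 + (1 / 2) ^ s) ^ j := by
    rw [add_pow]
    have := single_le_sum (f := fun m : ℕ => (1 : ℝ) ^ m * ((1 / 2) ^ s) ^ (j - m) * j.choose m)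
      (fun m _ => by positivity) (mem_range.2 (Nat.lt_succ_of_le hkj))
    simpa [mul_comm] using this
  have h3 := Real.logb_le_logb_of_le one_lt_two (by positivity) h1
  rw [Real.logb_mul hpos.ne' (by positivity), Real.logb_pow, Real.logb_pow, Real.logb_pow,
    one_div, Real.logb_inv, Real.logb_self_eq_one one_lt_two, Nat.cast_sub hkj] at h3
  have h4 : Real.logb 2 (1 + 2⁻¹ ^ s) ≤ 2 * (1 / 2) ^ s := by
    rw [Real.logb, div_le_iff₀ h2, one_div]
    have := Real.log_le_sub_one_of_pos (show (0 : ℝ) < 1 + 2⁻¹ ^ s by positivity)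
    have hl := Real.log_two_gt_d9
    have ht' : (0 : ℝ) < 2⁻¹ ^ s := by positivity
    nlinarith
  have h5 : (j : ℝ) * Real.logb 2 (1 + 2⁻¹ ^ s) ≤ n * (2 * (1 / 2) ^ s) :=
    mul_le_mul (by exact_mod_cast hjn) h4
      (Real.logb_nonneg one_lt_two (by linarith [show (0 : ℝ) < 2⁻¹ ^ s by positivity]))
      (by positivity)
  linarith

variable {n j k : ℕ} {p : (Fin n → Bool) → ℝ}

lemma mutualInfo_exactW_mono (hp : IsDist p) (hkj : k ≤ j) (hjn : j ≤ n) :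
    mutualInfo p (exactW (k := k)) ≤ mutualInfo p (exactW (k := j)) := by
  rw [← cascade_exactW hkj hjn]
  exact mutualInfo_cascade_le hp (isChannel_exactW hjn) (isChannel_exactW hkj)

lemma mutualInfo_exactW_le_add (hp : IsDist p) (hkj : k ≤ j) (hjn : j ≤ n) (s : ℕ) :
    mutualInfo p (exactW (k := j)) ≤ mutualInfo p (exactW (k := k)) +
      ((s + 1) * (j - k : ℝ) + 2 * (1 / 2) ^ s * n) := by
  have hpos : (0 : ℝ) < j.choose k := by exact_mod_cast Nat.choose_pos hkj
  have h := mutualInfo_le_cascade_add (M := j.choose k * 2 ^ (j - k)) hp (isChannel_exactW hjn)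
    (isChannel_exactW hkj) (by positivity)
    (fun y => by exact_mod_cast card_filter_exactW_ne_zero_le y)
  rw [cascade_exactW hkj hjn, Real.logb_mul hpos.ne' (by positivity), Real.logb_pow,
    Real.logb_self_eq_one one_lt_two, Nat.cast_sub hkj] at h
  linarith [logb_choose_le hkj hjn s]

/-- The information carried by the exact deletion channel depends continuously, uniformly in the
block length, on the fraction of symbols kept. -/
lemma abs_mutualInfo_exactW_sub_le (hp : IsDist p) (hj : j ≤ n) (hk : k ≤ n) (s : ℕ) :
    |mutualInfo p (exactW (k := j)) - mutualInfo p (exactW (k := k))| ≤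
      (s + 1) * |(j : ℝ) - k| + 2 * (1 / 2) ^ s * n := by
  wlog hkj : k ≤ j generalizing j k
  · rw [abs_sub_comm, abs_sub_comm (j : ℝ)]
    exact this hk hj (le_of_not_ge hkj)
  have h : (0 : ℝ) ≤ j - k := sub_nonneg.2 (by exact_mod_cast hkj)
  rw [abs_of_nonneg (sub_nonneg.2 (mutualInfo_exactW_mono hp hkj hj)), abs_of_nonneg h]
  linarith [mutualInfo_exactW_le_add hp hkj hj s]

end Exact

/-! ### The deletion channel -/

section Deletion

open Finset

lemma restrictSub_eq_mk_iff {n k : ℕ} (x : Fin n → Bool) (S : Finset (Fin n)) (hk : k < n + 1)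
    (y : Fin k → Bool) :
    restrictSub x S = ⟨⟨k, hk⟩, y⟩ ↔ ∃ h : S.card = k, x ∘ S.orderEmbOfFin h = y := by
  constructor
  · intro h
    have hc : S.card = k := congrArg (fun a : DelOut n => (a.1 : ℕ)) h
    subst hc
    exact ⟨rfl, by simpa [restrictSub, Function.comp_def] using h⟩
  · rintro ⟨rfl, rfl⟩
    rfl

lemma card_filter_restrictSub {n k : ℕ} (x : Fin n → Bool) (hk : k < n + 1) (y : Fin k → Bool) :
    (univ.filter fun S => restrictSub x S = ⟨⟨k, hk⟩, y⟩).card =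
      (univ.filter fun f : Fin k → Fin n => StrictMono f ∧ x ∘ f = y).card := by
  symm
  refine card_bij (fun f _ => univ.image f) ?_ ?_ ?_
  · intro f hf
    obtain ⟨hf, hy⟩ := (mem_filter.1 hf).2
    refine mem_filter.2 ⟨mem_univ _, (restrictSub_eq_mk_iff x _ hk y).2 ⟨hf.card_image_univ, ?_⟩⟩
    rw [← hf.eq_orderEmbOfFin_image, hy]
  · intro f hf g hg hfg
    exact (mem_filter.1 hf).2.1.eq_of_image_eq (mem_filter.1 hg).2.1 hfg
  · intro S hS
    obtain ⟨hS, hy⟩ := (restrictSub_eq_mk_iff x S hk y).1 (mem_filter.1 hS).2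
    exact ⟨S.orderEmbOfFin hS, mem_filter.2 ⟨mem_univ _, (S.orderEmbOfFin hS).strictMono, hy⟩,
      image_orderEmbOfFin_univ S hS⟩

/-- The probability that the deletion channel keeps `k` out of `n` symbols. -/
def keepProb (n : ℕ) (d : ℝ) (k : ℕ) : ℝ := n.choose k * (1 - d) ^ k * d ^ (n - k)

lemma delW_mk {n : ℕ} (d : ℝ) (x : Fin n → Bool) (k : Fin (n + 1)) (y : Fin (k : ℕ) → Bool) :
    delW d x ⟨k, y⟩ = keepProb n d k * exactW x y := by
  have h : (n.choose k : ℝ) ≠ 0 := by exact_mod_cast (Nat.choose_pos k.is_le).ne'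
  have hw : delW d x ⟨k, y⟩ = ∑ S : Finset (Fin n),
      if restrictSub x S = ⟨k, y⟩ then (1 - d) ^ (k : ℕ) * d ^ (n - k) else 0 := by
    refine sum_congr rfl fun S _ => ?_
    split_ifs with hS
    · obtain ⟨hc, -⟩ := (restrictSub_eq_mk_iff x S k.2 y).1 hS
      rw [hc]
    · rfl
  rw [hw, ← sum_filter, sum_const, card_filter_restrictSub x k.2 y, nsmul_eq_mul, exactW, keepProb]
  field_simp

variable {d : ℝ}

lemma isChannel_delW (hd : d ∈ Set.Icc (0 : ℝ) 1) (n : ℕ) :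
    IsChannel (delW (n := n) d) where
  nonneg x y := sum_nonneg fun S _ => by
    have := sub_nonneg.2 hd.2
    have := hd.1
    split_ifs <;> positivity
  sum_eq_one x := by
    simp only [delW]
    rw [sum_comm]
    simp [Fin.sum_pow_mul_eq_add_pow]

/-- The deletion channel is a mixture of exact deletion channels, with the mixing variable being
revealed by the output. -/
lemma mutualInfo_delW {n : ℕ} (p : (Fin n → Bool) → ℝ) (d : ℝ) :
    mutualInfo p (delW d) =
      ∑ k : Fin (n + 1), keepProb n d k * mutualInfo p (exactW (k := k)) := by
  simp only [mutualInfo, Fintype.sum_sigma, delW_mk, mul_sum]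
  rw [sum_comm]
  refine sum_congr rfl fun k _ => sum_congr rfl fun x _ => sum_congr rfl fun y _ => ?_
  simp only [mul_left_comm (p _) (keepProb n d k), ← mul_sum]
  rcases eq_or_ne (keepProb n d k) 0 with h | h
  · simp [h]
  · rw [mul_div_mul_left _ _ h]
    ring

lemma keepProb_nonneg (hd : d ∈ Set.Icc (0 : ℝ) 1) (n k : ℕ) : 0 ≤ keepProb n d k := by
  have := sub_nonneg.2 hd.2
  have := hd.1
  unfold keepProb
  positivity

lemma keepProb_eq_bernstein (hd : d ∈ Set.Icc (0 : ℝ) 1) (n k : ℕ) :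
    keepProb n d k = bernstein n k ⟨1 - d, sub_nonneg.2 hd.2, sub_le_self 1 hd.1⟩ := by
  simp [keepProb, bernstein_apply]

lemma sum_keepProb (hd : d ∈ Set.Icc (0 : ℝ) 1) (n : ℕ) :
    ∑ k : Fin (n + 1), keepProb n d k = 1 := by
  simp only [keepProb_eq_bernstein hd]
  exact bernstein.probability n _

lemma sum_keepProb_mul_sq (hd : d ∈ Set.Icc (0 : ℝ) 1) {n : ℕ} (hn : n ≠ 0) :
    ∑ k : Fin (n + 1), keepProb n d k * ((k : ℝ) / n - (1 - d)) ^ 2 = (1 - d) * d / n := by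
  have h := bernstein.variance hn ⟨1 - d, sub_nonneg.2 hd.2, sub_le_self 1 hd.1⟩
  simp only [← keepProb_eq_bernstein hd, bernstein.z, sub_sub_cancel] at h
  rw [← h]
  exact sum_congr rfl fun k _ => by ring

/-- Concentration of the fraction of symbols that are kept. -/
lemma sum_keepProb_mul_abs_le (hd : d ∈ Set.Icc (0 : ℝ) 1) {n : ℕ} (hn : n ≠ 0) (r : ℝ) {δ : ℝ}
    (hδ : 0 < δ) :
    ∑ k : Fin (n + 1), keepProb n d k * |(k : ℝ) / n - r| ≤
      δ + 1 / δ / n + |r - (1 - d)| := by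
  calc ∑ k : Fin (n + 1), keepProb n d k * |(k : ℝ) / n - r|
      ≤ ∑ k : Fin (n + 1), (keepProb n d k * (δ + |r - (1 - d)|) +
          keepProb n d k * ((k : ℝ) / n - (1 - d)) ^ 2 * (1 / δ)) := by
        refine sum_le_sum fun k _ => ?_
        rw [mul_assoc, ← mul_add]
        refine mul_le_mul_of_nonneg_left ?_ (keepProb_nonneg hd n k)
        have h1 : |(k : ℝ) / n - r| ≤ |(k : ℝ) / n - (1 - d)| + |r - (1 - d)| := by
          rw [abs_sub_comm r]
          exact abs_sub_le _ _ _
        have h2 : |(k : ℝ) / n - (1 - d)| ≤ δ + ((k : ℝ) / n - (1 - d)) ^ 2 * (1 / δ) := by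
          rw [mul_one_div, ← sq_abs, ← sub_le_iff_le_add', le_div_iff₀ hδ]
          nlinarith [sq_nonneg (|(k : ℝ) / n - (1 - d)| - δ), abs_nonneg ((k : ℝ) / n - (1 - d))]
        linarith
    _ = δ + |r - (1 - d)| + (1 - d) * d / n * (1 / δ) := by
        rw [sum_add_distrib, ← sum_mul, ← sum_mul, sum_keepProb hd, sum_keepProb_mul_sq hd hn,
          one_mul]
    _ ≤ δ + |r - (1 - d)| + 1 / n * (1 / δ) := by
        have : (1 - d) * d ≤ 1 := by nlinarith [hd.1, hd.2]
        gcongr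
    _ = δ + 1 / δ / n + |r - (1 - d)| := by ring

lemma abs_mutualInfo_delW_sub_le (hd : d ∈ Set.Icc (0 : ℝ) 1) {n k : ℕ} (hn : n ≠ 0) (hk : k ≤ n)
    {p : (Fin n → Bool) → ℝ} (hp : IsDist p) (s : ℕ) {δ : ℝ} (hδ : 0 < δ) :
    |mutualInfo p (delW d) - mutualInfo p (exactW (k := k))| ≤
      n * ((s + 1) * (δ + 1 / δ / n + |(k : ℝ) / n - (1 - d)|) + 2 * (1 / 2) ^ s) := by
  have hn' : (0 : ℝ) < n := by exact_mod_cast Nat.pos_of_ne_zero hn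
  have h : mutualInfo p (delW d) - mutualInfo p (exactW (k := k)) = ∑ j : Fin (n + 1),
      keepProb n d j * (mutualInfo p (exactW (k := j)) - mutualInfo p (exactW (k := k))) := by
    simp only [mul_sub, sum_sub_distrib, ← sum_mul, sum_keepProb hd, one_mul, mutualInfo_delW]
  rw [h]
  calc _ ≤ ∑ j : Fin (n + 1), keepProb n d j *
          ((s + 1) * |(j : ℝ) - k| + 2 * (1 / 2) ^ s * n) := by
        refine (abs_sum_le_sum_abs _ _).trans (sum_le_sum fun j _ => ?_)
        rw [abs_mul, abs_of_nonneg (keepProb_nonneg hd n j)]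
        exact mul_le_mul_of_nonneg_left (abs_mutualInfo_exactW_sub_le hp j.is_le hk s)
          (keepProb_nonneg hd n j)
    _ = ∑ j : Fin (n + 1), (keepProb n d j * |(j : ℝ) / n - (k : ℝ) / n| * (n * (s + 1)) +
          keepProb n d j * (2 * (1 / 2) ^ s * n)) := by
        refine sum_congr rfl fun j _ => ?_
        rw [← sub_div, abs_div, abs_of_pos hn']
        field_simp
    _ = n * ((s + 1) * ∑ j : Fin (n + 1), keepProb n d j * |(j : ℝ) / n - (k : ℝ) / n| +
          2 * (1 / 2) ^ s) := by
        rw [sum_add_distrib, ← sum_mul, ← sum_mul, sum_keepProb hd]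
        ring
    _ ≤ _ := by
        gcongr
        exact sum_keepProb_mul_abs_le hd hn _ hδ

lemma abs_iSup_sub_iSup_le {ι : Type*} [Nonempty ι] {f g : ι → ℝ} (hf : BddAbove (Set.range f))
    (hg : BddAbove (Set.range g)) {c : ℝ} (h : ∀ i, |f i - g i| ≤ c) :
    |(⨆ i, f i) - ⨆ i, g i| ≤ c := by
  rw [abs_sub_le_iff, sub_le_iff_le_add, sub_le_iff_le_add]
  refine ⟨ciSup_le fun i => ?_, ciSup_le fun i => ?_⟩
  · linarith [(abs_le.1 (h i)).2, le_ciSup hg i]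
  · linarith [(abs_le.1 (h i)).1, le_ciSup hf i]

lemma abs_Cn_sub_Cnk_le (hd : d ∈ Set.Icc (0 : ℝ) 1) {n k : ℕ} (hn : n ≠ 0) (hk : k ≤ n) (s : ℕ)
    {δ : ℝ} (hδ : 0 < δ) :
    |Cn n d - Cnk n k| ≤
      (s + 1) * (δ + 1 / δ / n + |(k : ℝ) / n - (1 - d)|) + 2 * (1 / 2) ^ s := by
  have hn' : (0 : ℝ) < n := by exact_mod_cast Nat.pos_of_ne_zero hn
  have : Nonempty (DelOut n) := ⟨restrictSub (fun _ => false) ∅⟩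
  have := nonempty_isDist (α := Fin n → Bool)
  rw [Cn, Cnk, ← mul_sub, abs_mul, abs_of_pos (by positivity), one_div_mul_eq_div, div_le_iff₀' hn']
  exact abs_iSup_sub_iSup_le (bddAbove_mutualInfo (isChannel_delW hd n))
    (bddAbove_mutualInfo (isChannel_exactW hk))
    fun p => abs_mutualInfo_delW_sub_le hd hn hk p.2 s hδ

lemma tendsto_Cn_sub_Cnk (hd : d ∈ Set.Icc (0 : ℝ) 1) {k : ℕ → ℕ} (hk : ∀ n, k n ≤ n)
    (hlim : Filter.Tendsto (fun n : ℕ => (k n : ℝ) / n) Filter.atTop (nhds (1 - d))) :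
    Filter.Tendsto (fun n : ℕ => Cn n d - Cnk n (k n)) Filter.atTop (nhds 0) := by
  rw [Metric.tendsto_nhds]
  intro ε hε
  obtain ⟨s, hs⟩ := exists_pow_lt_of_lt_one (show 0 < ε / 4 by positivity)
    (show (1 / 2 : ℝ) < 1 by norm_num)
  set δ : ℝ := ε / (4 * (s + 1)) with hδ
  have hδ0 : 0 < δ := by positivity
  have hδε : ((s : ℝ) + 1) * δ = ε / 4 := by
    rw [hδ]
    field_simp
  have hbound : Filter.Tendsto
      (fun n : ℕ => ((s : ℝ) + 1) * (δ + 1 / δ / n + |(k n : ℝ) / n - (1 - d)|) +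
        2 * (1 / 2) ^ s) Filter.atTop
      (nhds ((s + 1) * (δ + 0 + |(1 - d) - (1 - d)|) + 2 * (1 / 2) ^ s)) :=
    (((tendsto_const_nhds.add (tendsto_const_div_atTop_nhds_zero_nat (1 / δ))).add
      (hlim.sub_const (1 - d)).abs).const_mul _).add_const _
  have hlt : ((s : ℝ) + 1) * (δ + 0 + |(1 - d) - (1 - d)|) + 2 * (1 / 2) ^ s < ε := by
    rw [sub_self, abs_zero, add_zero, add_zero, hδε]
    linarith
  filter_upwards [hbound.eventually_lt_const hlt, Filter.eventually_ne_atTop 0] with n hn hn0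
  rw [Real.dist_eq, sub_zero]
  exact (abs_Cn_sub_Cnk_le hd hn0 (hk n) s hδ0).trans_lt hn

/-! ### Subadditivity -/

/-- The output of the deletion channel as a list. -/
def DelOut.toList {n : ℕ} (a : DelOut n) : List Bool := List.ofFn a.2

lemma DelOut.toList_injective {n : ℕ} : Function.Injective (DelOut.toList (n := n)) := by
  rintro ⟨⟨k, hk⟩, y⟩ ⟨⟨l, hl⟩, z⟩ h
  simp only [DelOut.toList] at h
  obtain rfl : k = l := by simpa using congrArg List.length h
  rw [List.ofFn_injective h]

/-- Concatenation of outputs of the deletion channel. -/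
def DelOut.concat {n m : ℕ} (a : DelOut n) (b : DelOut m) : DelOut (n + m) :=
  ⟨⟨a.1 + b.1, by omega⟩, Fin.append a.2 b.2⟩

lemma DelOut.toList_concat {n m : ℕ} (a : DelOut n) (b : DelOut m) :
    (a.concat b).toList = a.toList ++ b.toList :=
  List.ofFn_fin_append a.2 b.2

lemma toList_restrictSub {n : ℕ} (x : Fin n → Bool) (S : Finset (Fin n)) :
    (restrictSub x S).toList = S.sort.map x := by
  rw [← listMap_orderEmbOfFin_finRange S rfl, List.map_map, ← List.ofFn_eq_map]
  rfl

/-- A set of positions in a concatenation amounts to a set of positions in either part. -/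
def finsetFinAddEquiv (n m : ℕ) : Finset (Fin n) × Finset (Fin m) ≃ Finset (Fin (n + m)) :=
  Finset.sumEquiv.toEquiv.symm.trans finSumFinEquiv.finsetCongr

lemma finsetFinAddEquiv_apply {n m : ℕ} (S : Finset (Fin n)) (T : Finset (Fin m)) :
    finsetFinAddEquiv n m (S, T) = (S.disjSum T).map finSumFinEquiv.toEmbedding := rfl

lemma card_finsetFinAddEquiv {n m : ℕ} (S : Finset (Fin n)) (T : Finset (Fin m)) :
    (finsetFinAddEquiv n m (S, T)).card = S.card + T.card := by
  rw [finsetFinAddEquiv_apply, card_map, card_disjSum]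

lemma sort_finsetFinAddEquiv {n m : ℕ} (S : Finset (Fin n)) (T : Finset (Fin m)) :
    (finsetFinAddEquiv n m (S, T)).sort =
      S.sort.map (Fin.castAdd m) ++ T.sort.map (Fin.natAdd n) := by
  set l := S.sort.map (Fin.castAdd m) ++ T.sort.map (Fin.natAdd n) with hl
  have hlt : l.Pairwise (· < ·) := by
    rw [hl, List.pairwise_append, List.pairwise_map, List.pairwise_map]
    refine ⟨(sortedLT_sort S).pairwise.imp fun h => ?_,
      (sortedLT_sort T).pairwise.imp fun h => ?_, ?_⟩
    · exact h
    · simpa using h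
    · intro a ha b hb
      obtain ⟨i, -, rfl⟩ := List.mem_map.1 ha
      obtain ⟨j, -, rfl⟩ := List.mem_map.1 hb
      exact Fin.lt_def.2 (by simp only [Fin.val_castAdd, Fin.val_natAdd]; omega)
  have hmem : finsetFinAddEquiv n m (S, T) = l.toFinset := by
    ext a
    simp only [finsetFinAddEquiv_apply, hl, mem_disjSum, mem_map, List.mem_toFinset,
      List.mem_append, List.mem_map, mem_sort]
    constructor
    · rintro ⟨_, ⟨i, hi, rfl⟩ | ⟨j, hj, rfl⟩, rfl⟩
      exacts [Or.inl ⟨i, hi, rfl⟩, Or.inr ⟨j, hj, rfl⟩]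
    · rintro (⟨i, hi, rfl⟩ | ⟨j, hj, rfl⟩)
      exacts [⟨_, Or.inl ⟨i, hi, rfl⟩, rfl⟩, ⟨_, Or.inr ⟨j, hj, rfl⟩, rfl⟩]
  rw [hmem]
  exact (List.toFinset_sort (· ≤ ·) (hlt.imp fun h => h.ne)).2 (hlt.imp fun h => h.le)

lemma restrictSub_append {n m : ℕ} (x : Fin n → Bool) (y : Fin m → Bool) (S : Finset (Fin n))
    (T : Finset (Fin m)) :
    restrictSub (Fin.append x y) (finsetFinAddEquiv n m (S, T)) =
      (restrictSub x S).concat (restrictSub y T) := by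
  apply DelOut.toList_injective
  rw [DelOut.toList_concat, toList_restrictSub, toList_restrictSub, toList_restrictSub,
    sort_finsetFinAddEquiv, List.map_append, List.map_map, List.map_map]
  simp [Function.comp_def]

/-- The noiseless channel concatenating two outputs of deletion channels. -/
def concatChannel (n m : ℕ) (y : DelOut n × DelOut m) (z : DelOut (n + m)) : ℝ :=
  if y.1.concat y.2 = z then 1 else 0

lemma isChannel_concatChannel (n m : ℕ) : IsChannel (concatChannel n m) where
  nonneg y z := by unfold concatChannel; split_ifs <;> norm_num
  sum_eq_one y := by simp [concatChannel]

/-- Deletions act independently on the two parts of a concatenation. -/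
lemma delW_append (n m : ℕ) (d : ℝ) :
    delW d ∘ Fin.appendEquiv n m =
      cascade (prodChannel (delW (n := n) d) (delW (n := m) d)) (concatChannel n m) := by
  funext ⟨x, y⟩ z
  have hl : (delW d ∘ Fin.appendEquiv n m) (x, y) z =
      ∑ S : Finset (Fin n), ∑ T : Finset (Fin m),
        if (restrictSub x S).concat (restrictSub y T) = z then
          ((1 - d) ^ S.card * d ^ (n - S.card)) * ((1 - d) ^ T.card * d ^ (m - T.card)) else 0 := by
    rw [Function.comp_apply, delW, ← (finsetFinAddEquiv n m).sum_comp, Fintype.sum_prod_type]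
    refine sum_congr rfl fun S _ => sum_congr rfl fun T _ => ?_
    have hS : S.card ≤ n := by simpa using card_le_univ S
    have hT : T.card ≤ m := by simpa using card_le_univ T
    have he : n + m - (S.card + T.card) = (n - S.card) + (m - T.card) := by omega
    rw [show Fin.appendEquiv n m (x, y) = Fin.append x y from rfl, restrictSub_append,
      card_finsetFinAddEquiv, he, pow_add, pow_add]
    congr 1
    ring
  have hr : ∀ a : DelOut n × DelOut m,
      prodChannel (delW d) (delW d) (x, y) a * concatChannel n m a z =
        ∑ S : Finset (Fin n), ∑ T : Finset (Fin m),
          if (restrictSub x S, restrictSub y T) = a then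
            (if (restrictSub x S).concat (restrictSub y T) = z then
              ((1 - d) ^ S.card * d ^ (n - S.card)) * ((1 - d) ^ T.card * d ^ (m - T.card))
              else 0) else 0 := by
    rintro ⟨a, b⟩
    simp only [prodChannel, delW, concatChannel, Prod.mk.injEq]
    rw [sum_mul_sum, sum_mul]
    simp only [sum_mul]
    refine sum_congr rfl fun S _ => sum_congr rfl fun T _ => ?_
    by_cases h1 : restrictSub x S = a
    · by_cases h2 : restrictSub y T = b
      · simp [h1, h2]
      · simp [h2]
    · simp [h1]
  rw [hl, cascade, sum_congr rfl fun a _ => hr a]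
  symm
  rw [sum_comm]
  refine sum_congr rfl fun S _ => ?_
  rw [sum_comm]
  refine sum_congr rfl fun T _ => ?_
  rw [sum_ite_eq, if_pos (mem_univ _)]

lemma subadditive_iSup_mutualInfo_delW (hd : d ∈ Set.Icc (0 : ℝ) 1) :
    Subadditive fun n => ⨆ p : {p : (Fin n → Bool) → ℝ // IsDist p}, mutualInfo p.1 (delW d) := by
  intro n m
  have hbdd (n : ℕ) : BddAbove (Set.range fun p : {p : (Fin n → Bool) → ℝ // IsDist p} =>
      mutualInfo p.1 (delW d)) := by
    have : Nonempty (DelOut n) := ⟨restrictSub (fun _ => false) ∅⟩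
    exact bddAbove_mutualInfo (isChannel_delW hd n)
  have := nonempty_isDist (α := Fin (n + m) → Bool)
  refine ciSup_le fun p => ?_
  have hp := p.2.comp_equiv (Fin.appendEquiv n m)
  have hprod := (isChannel_delW hd n).prodChannel (isChannel_delW hd m)
  calc mutualInfo p.1 (delW d)
      = mutualInfo (p.1 ∘ Fin.appendEquiv n m) (delW d ∘ Fin.appendEquiv n m) :=
        (mutualInfo_comp_equiv _ _ _).symm
    _ ≤ mutualInfo (p.1 ∘ Fin.appendEquiv n m) (prodChannel (delW d) (delW d)) := by
        rw [delW_append]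
        exact mutualInfo_cascade_le hp hprod (isChannel_concatChannel n m)
    _ ≤ _ := mutualInfo_prodChannel_le hp (isChannel_delW hd n) (isChannel_delW hd m)
    _ ≤ _ := add_le_add (le_ciSup (hbdd n) ⟨_, hp.fst⟩) (le_ciSup (hbdd m) ⟨_, hp.snd⟩)

lemma tendsto_Cn (hd : d ∈ Set.Icc (0 : ℝ) 1) :
    Filter.Tendsto (fun n : ℕ => Cn n d) Filter.atTop (nhds (C d)) := by
  have hsub := subadditive_iSup_mutualInfo_delW hd
  have hbdd : BddBelow (Set.range fun n : ℕ =>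
      (⨆ p : {p : (Fin n → Bool) → ℝ // IsDist p}, mutualInfo p.1 (delW d)) / (n : ℝ)) := by
    refine ⟨0, ?_⟩
    rintro _ ⟨n, rfl⟩
    exact div_nonneg (Real.iSup_nonneg fun p => mutualInfo_nonneg p.2 (isChannel_delW hd n))
      n.cast_nonneg
  have h := hsub.tendsto_lim hbdd
  have hC : hsub.lim = C d := by
    rw [Subadditive.lim, C, iInf, Set.image_eq_range]
    simp only [Cn, one_div_mul_eq_div]
    rfl
  rw [hC] at h
  simpa only [Cn, one_div_mul_eq_div] using h

end Deletion

/-- If `d ∈ [0,1]` and `(k_n)` is a sequence of integers with `0 ≤ k_n ≤ n`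
such that `k_n/n → 1 − d`, then `lim_{n→∞} C_{n,k_n} = C(d)`. -/
theorem tendsto_Cnk (d : ℝ) (hd : d ∈ Set.Icc (0 : ℝ) 1) (k : ℕ → ℕ) (hk : ∀ n, k n ≤ n)
    (hlim : Filter.Tendsto (fun n : ℕ => (k n : ℝ) / n) Filter.atTop (nhds (1 - d))) :
    Filter.Tendsto (fun n : ℕ => Cnk n (k n)) Filter.atTop (nhds (C d)) := by
  simpa using (tendsto_Cn hd).sub (tendsto_Cn_sub_Cnk hd hk hlim)
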